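/- arXiv:2308.08034 — 2 statements merged into one kernel-verified Lean document; each statement's English description precedes it below -/
import Mathlib

section
/- Fix an integer r ≥ 1 and let s, B, b_0,…,b_{2r+1}, t_2, g_2, w_2 be as defined; set Q := b_2 b_3 ⋯ b_{2r−1} (with Q = 1 when r = 1), and let b″ be the integer satisfying 3·b″ = 1 + 8·Q + 12·t_2. Define u″ := 2·Q + 3·t_2 (so 4u″ = 3b″ − 1), m″ := 3·b″·g_2 − 2, and v″ := 4·g_2 + w_2. Then 2·m″·u″ − 1 = (b_1 b_2 ⋯ b_{2r−1})·b″·v″. (This is identity (7.2) for even dimension n = 2r: in the paper's notation 2 m′_{2r} u′_{2r} − 1 = b_1⋯b_{2r−1} b′_{2r} v′_{2r}; e.g. for r = 1 it reads 2·19·5 − 1 = 3·7·9, and for r = 2 it reads 2·1201495·1187 − 1 = 777·1583·2319.) -/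
/-- Sylvester's sequence: `s 0 = 2`, `s (j+1) = s j * (s j − 1) + 1`;
it begins 2, 3, 7, 43, 1807, …. -/
def sylv : ℕ → ℕ
  | 0 => 2
  | n + 1 => sylv n * (sylv n - 1) + 1

/-- The alternating sum `B(x₁,…,x_k) = ∑_{j=0}^{k} (−1)^{k−j} x₁⋯x_j`
(the empty product being 1), characterized by `B [] = 1` and
`B (x :: xs) = x * B xs + (−1)^(length (x :: xs))`. -/
def Bsum : List ℤ → ℤ
  | [] => 1
  | x :: xs => x * Bsum xs + (-1) ^ (xs.length + 1)

/-- `Zl r t` is the list of length `2t` formed by concatenating the pairs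
`(b_{r+u}, b_{r+1−u})` for `u = 1, …, t`, where `b` are the exponents
defined inductively together with this list. -/
def Zl (r : ℕ) : ℕ → List ℤ
  | 0 => []
  | t + 1 => Zl r t ++ [1 + ((sylv (r - t) : ℤ) - 1) ^ 2 * Bsum (Zl r t), (sylv (r - t) : ℤ)]

/-- The exponents `b_0, …, b_{2r+1}`: `b_j = s_j` for `j ≤ r`, and
`b_{r+i} = 1 + (b_{r+1−i} − 1)² · B(Z_{i−1})` for `1 ≤ i ≤ r+1`
(here, for `j = r + i`, one has `b_{r+1−i} = s_{2r+1−j}`). -/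
def bexp (r j : ℕ) : ℤ :=
  if j ≤ r then (sylv j : ℤ)
  else 1 + ((sylv (2 * r + 1 - j) : ℤ) - 1) ^ 2 * Bsum (Zl r (j - r - 1))

/-- The list `L_k = (b_{r+1}, b_r, b_{r+2}, b_{r−1}, …, b_{2r+1−k}, b_k)`,
formed by concatenating the pairs `(b_{r+t}, b_{r+1−t})` for `t = 1, …, r+1−k`. -/
def Lk (r k : ℕ) : List ℤ := Zl r (r + 1 - k)

/-- `t_k := B(L_k)`. -/
def tB (r k : ℕ) : ℤ := Bsum (Lk r k)

/-- `g_k := B(reverse of L_k)`. -/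
def gB (r k : ℕ) : ℤ := Bsum (Lk r k).reverse

/-- `T_k`: the alternating sum of `B` over the suffixes of `L_k`
(the full list with sign `+`, the empty suffix contributing `+1`). -/
def TB (r k : ℕ) : ℤ :=
  ∑ m ∈ Finset.range ((Lk r k).length + 1), (-1) ^ m * Bsum ((Lk r k).drop m)

/-- `w_k := (s_k − 1)·T_k − 1`. -/
def wB (r k : ℕ) : ℤ := ((sylv k : ℤ) - 1) * TB r k - 1

theorem Bsum_append_singleton (l : List ℤ) (x : ℤ) :
    Bsum (l ++ [x]) = l.prod * x - Bsum l := by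
  induction l with
  | nil => simp [Bsum]; ring
  | cons y l ih =>
    simp only [List.cons_append, Bsum, ih, List.length_append, List.length_singleton,
      List.prod_cons]
    ring

theorem Bsum_reverse (l : List ℤ) :
    Bsum l.reverse = ∑ m ∈ Finset.range (l.length + 1), (-1) ^ m * (l.drop m).prod := by
  induction l with
  | nil => simp [Bsum]
  | cons x l ih =>
    rw [List.reverse_cons, Bsum_append_singleton, ih, List.length_cons,
      Finset.sum_range_succ' _ (l.length + 1)]
    simp only [List.drop_succ_cons, pow_succ, List.drop_zero, List.prod_cons, List.prod_reverse,
      mul_neg, mul_one, neg_mul, Finset.sum_neg_distrib]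
    ring

/-- The alternating sum of `Bsum` over the suffixes of a list. -/
def suffixBsum (l : List ℤ) : ℤ :=
  ∑ m ∈ Finset.range (l.length + 1), (-1) ^ m * Bsum (l.drop m)

theorem suffixBsum_append_singleton (l : List ℤ) (x : ℤ) :
    suffixBsum (l ++ [x]) =
      x * Bsum l.reverse - suffixBsum l + (-1) ^ (l.length + 1) := by
  have key : ∀ m ∈ Finset.range (l.length + 1),
      (-1) ^ m * Bsum ((l ++ [x]).drop m) =
        x * ((-1) ^ m * (l.drop m).prod) - (-1) ^ m * Bsum (l.drop m) := by
    intro m hm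
    rw [List.drop_append_of_le_length (by simpa [Nat.lt_succ_iff] using hm),
      Bsum_append_singleton]
    ring
  rw [suffixBsum, List.length_append, List.length_singleton, Finset.sum_range_succ,
    Finset.sum_congr rfl key, Finset.sum_sub_distrib, ← Finset.mul_sum, ← Bsum_reverse,
    List.drop_of_length_le (by simp), suffixBsum]
  simp [Bsum]

theorem length_Zl (r t : ℕ) : (Zl r t).length = 2 * t := by
  induction t with
  | zero => rfl
  | succ t ih => simp [Zl, ih]; ring

theorem neg_one_pow_length_Zl (r t : ℕ) : (-1 : ℤ) ^ (Zl r t).length = 1 := by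
  rw [length_Zl, pow_mul]; simp

theorem sylv_succ_sub_one (n : ℕ) :
    (sylv (n + 1) : ℤ) - 1 = sylv n * ((sylv n : ℤ) - 1) := by
  have h : 1 ≤ sylv n := by cases n <;> simp [sylv]
  simp [sylv, Nat.cast_sub h]

theorem prod_Zl (r t : ℕ) (ht : t ≤ r + 1) :
    (Zl r t).prod = ∏ j ∈ Finset.Icc (r + 1 - t) (r + t), bexp r j := by
  induction t with
  | zero => simp [Zl]
  | succ t ih =>
    have hlow : bexp r (r - t) = sylv (r - t) := by simp [bexp]
    have hhigh : bexp r (r + t + 1) =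
        1 + ((sylv (r - t) : ℤ) - 1) ^ 2 * Bsum (Zl r t) := by
      rw [bexp, if_neg (by omega), show 2 * r + 1 - (r + t + 1) = r - t by omega,
        show r + t + 1 - r - 1 = t by omega]
    rw [show r + 1 - (t + 1) = r - t by omega, ← add_assoc,
      Finset.prod_Icc_succ_top (by omega), hhigh,
      ← Finset.mul_prod_Ioc_eq_prod_Icc (by omega : r - t ≤ r + t), hlow,
      ← Finset.Icc_add_one_left_eq_Ioc, show r - t + 1 = r + 1 - t by omega, ← ih (by omega)]
    simp only [Zl, List.prod_append, List.prod_cons, List.prod_nil]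
    ring

theorem sylv_sub_one_mul_Bsum_reverse_mul_Bsum_sub (r t : ℕ) (ht : t ≤ r + 1) :
    ((sylv (r + 1 - t) : ℤ) - 1) *
        (Bsum (Zl r t).reverse * Bsum (Zl r t) - (Zl r t).prod * suffixBsum (Zl r t)) =
      1 - (Zl r t).prod := by
  induction t with
  | zero => simp [Zl, Bsum, suffixBsum]
  | succ t ih =>
    replace ih := ih (by omega)
    rw [show r + 1 - t = r - t + 1 by omega, sylv_succ_sub_one] at ih
    have hsign := neg_one_pow_length_Zl r t
    rw [show r + 1 - (t + 1) = r - t by omega, Zl]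
    generalize (sylv (r - t) : ℤ) = α at *
    generalize hβ : 1 + (α - 1) ^ 2 * Bsum (Zl r t) = β
    rw [List.append_cons]
    simp only [Bsum_append_singleton, suffixBsum_append_singleton, List.reverse_append,
      List.reverse_singleton, List.singleton_append, Bsum, List.prod_append,
      List.prod_singleton, List.length_append, List.length_cons,
      List.length_nil, List.length_reverse, pow_add, pow_zero, pow_one, hsign]
    linear_combination β * ih - hβ

theorem prod_Icc_one_bexp (r : ℕ) (hr : 1 ≤ r) :
    ∏ j ∈ Finset.Icc 1 (2 * r - 1), bexp r j =
      3 * ∏ j ∈ Finset.Icc 2 (2 * r - 1), bexp r j := by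
  rw [← Finset.mul_prod_Ioc_eq_prod_Icc (by omega : 1 ≤ 2 * r - 1),
    ← Finset.Icc_add_one_left_eq_Ioc]
  simp [bexp, hr, sylv]

/-- Identity (7.2) of Esser–Totaro in even dimension `n = 2r`:
with `Q = b_2⋯b_{2r−1}`, `3b″ = 1 + 8Q + 12t_2`, `u″ = 2Q + 3t_2`,
`m″ = 3b″g_2 − 2` and `v″ = 4g_2 + w_2`, one has
`2·m″·u″ − 1 = b_1⋯b_{2r−1}·b″·v″`
(e.g. for `r = 1` it reads `2·19·5 − 1 = 3·7·9`). -/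
theorem large_index_identity_even (r : ℕ) (hr : 1 ≤ r) (b'' : ℤ)
    (hb : 3 * b'' = 1 + 8 * (∏ j ∈ Finset.Icc 2 (2 * r - 1), bexp r j) + 12 * tB r 2) :
    2 * (3 * b'' * gB r 2 - 2) *
        (2 * (∏ j ∈ Finset.Icc 2 (2 * r - 1), bexp r j) + 3 * tB r 2) - 1 =
      (∏ j ∈ Finset.Icc 1 (2 * r - 1), bexp r j) * b'' * (4 * gB r 2 + wB r 2) := by
  have hQ := prod_Zl r (r - 1) (by omega)
  have key := sylv_sub_one_mul_Bsum_reverse_mul_Bsum_sub r (r - 1) (by omega)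
  rw [hQ, show r + 1 - (r - 1) = 2 by omega, show r + (r - 1) = 2 * r - 1 by omega,
    show r - 1 = r + 1 - 2 by omega] at key
  change ((sylv 2 : ℤ) - 1) * (gB r 2 * tB r 2 - _ * TB r 2) = _ at key
  have h2 : (sylv 2 : ℤ) = 7 := by simp [sylv]
  rw [prod_Icc_one_bexp r hr, wB]
  rw [h2] at key ⊢
  generalize ∏ j ∈ Finset.Icc 2 (2 * r - 1), bexp r j = Q at *
  linear_combination (3 * b'') * key + hb
end

section
/- Fix an integer r ≥ 1 and let s, B, b_0,…,b_{2r+1}, g_0, g_1 be as defined, and let α := 2·Π_{j=1}^{∞} (s_{j+1}/(s_j − 1)²)^(2^(j−1)) (a convergent infinite product of positive reals). Then, as real numbers, s_{2r+1} − 1 ≤ α·g_1 and s_{2r+2} − 1 ≤ (3α²/4)·g_0. (This is Lemma 8.1: the mld 1/m_n of Esser's klt Calabi–Yau variety of dimension n satisfies 1/m_n ≤ α/(s_{n+1} − 1) for n even and 1/m_n ≤ (3α²/4)/(s_{n+1} − 1) for n odd, where m_{2r} = g_1 and m_{2r+1} = g_0.) -/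
theorem two_le_sylv (n : ℕ) : 2 ≤ sylv n := by
  induction n with
  | zero => simp [sylv]
  | succ n ih =>
    have h : 1 ≤ sylv n - 1 := by omega
    have := Nat.mul_le_mul ih h
    simp only [sylv]
    omega

theorem sylv_succ_int (n : ℕ) : (sylv (n + 1) : ℤ) = sylv n * ((sylv n : ℤ) - 1) + 1 := by
  have h : 1 ≤ sylv n := by have := two_le_sylv n; omega
  simp [sylv, Nat.cast_sub h]

theorem sylv_succ_real (n : ℕ) : (sylv (n + 1) : ℝ) = sylv n * ((sylv n : ℝ) - 1) + 1 := by
  exact_mod_cast sylv_succ_int n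

theorem two_le_sylv_real (n : ℕ) : (2 : ℝ) ≤ sylv n := by
  exact_mod_cast two_le_sylv n

theorem sylv_succ_le_sq (n : ℕ) : (sylv (n + 1) : ℝ) ≤ (sylv n : ℝ) ^ 2 := by
  rw [sylv_succ_real]
  nlinarith [two_le_sylv_real n]

/-- The ratio `s_{j+1} / (s_j - 1)²`. -/
noncomputable def sylvRatio (j : ℕ) : ℝ := (sylv (j + 1) : ℝ) / ((sylv j : ℝ) - 1) ^ 2

theorem one_le_sylvRatio (j : ℕ) : 1 ≤ sylvRatio j := by
  have h := two_le_sylv_real j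
  rw [sylvRatio, one_le_div (by nlinarith), sylv_succ_real]
  nlinarith

theorem Bsum_append_pair (l : List ℤ) (x y : ℤ) :
    Bsum (l ++ [x, y]) = l.prod * x * (y - 1) + Bsum l := by
  have h : l ++ [x, y] = (l ++ [x]) ++ [y] := by simp
  rw [h, Bsum_append_singleton, Bsum_append_singleton]
  simp
  ring

theorem Bsum_Zl_succ (r t : ℕ) :
    Bsum (Zl r (t + 1)) = (Zl r t).prod *
      (1 + ((sylv (r - t) : ℤ) - 1) ^ 2 * Bsum (Zl r t)) * ((sylv (r - t) : ℤ) - 1)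
      + Bsum (Zl r t) := by
  rw [Zl, Bsum_append_pair]

theorem prod_Zl_succ (r t : ℕ) :
    (Zl r (t + 1)).prod = (Zl r t).prod *
      (1 + ((sylv (r - t) : ℤ) - 1) ^ 2 * Bsum (Zl r t)) * sylv (r - t) := by
  simp [Zl, mul_assoc]

theorem Bsum_reverse_Zl_succ (r t : ℕ) :
    Bsum (Zl r (t + 1)).reverse = sylv (r - t) *
      ((1 + ((sylv (r - t) : ℤ) - 1) ^ 2 * Bsum (Zl r t)) * Bsum (Zl r t).reverse - 1) + 1 := by
  simp [Zl, Bsum, length_Zl, pow_succ, pow_mul, sub_eq_add_neg]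

theorem Zl_bounds (r t : ℕ) :
    1 ≤ Bsum (Zl r t) ∧ 1 ≤ Bsum (Zl r t).reverse ∧ Bsum (Zl r t).reverse ≤ (Zl r t).prod := by
  induction t with
  | zero => simp [Zl, Bsum]
  | succ t ih =>
    obtain ⟨hβ, hγ, hπ⟩ := ih
    rw [Bsum_Zl_succ, Bsum_reverse_Zl_succ, prod_Zl_succ]
    have hs : (2 : ℤ) ≤ sylv (r - t) := by exact_mod_cast two_le_sylv (r - t)
    generalize (sylv (r - t) : ℤ) = s at *
    generalize Bsum (Zl r t) = β at *
    generalize Bsum (Zl r t).reverse = γ at *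
    generalize (Zl r t).prod = π at *
    have hX : 1 ≤ 1 + (s - 1) ^ 2 * β := by
      have : 0 ≤ (s - 1) ^ 2 * β := by positivity
      linarith
    generalize 1 + (s - 1) ^ 2 * β = X at *
    have hXγ : 1 ≤ X * γ := by nlinarith
    have hπX : X * γ ≤ π * X := by nlinarith
    refine ⟨?_, ?_, ?_⟩
    · have : 0 ≤ π * X * (s - 1) := mul_nonneg (by linarith) (by linarith)
      linarith
    · nlinarith
    · nlinarith

theorem Bsum_reverse_Zl_succ_ge (r t : ℕ) :
    sylv (r - t) * ((sylv (r - t) : ℤ) - 1) ^ 2 * Bsum (Zl r t) * Bsum (Zl r t).reverse + 1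
      ≤ Bsum (Zl r (t + 1)).reverse := by
  obtain ⟨-, hγ, -⟩ := Zl_bounds r t
  rw [Bsum_reverse_Zl_succ]
  have : (0 : ℤ) ≤ sylv (r - t) * (Bsum (Zl r t).reverse - 1) :=
    mul_nonneg (by positivity) (by linarith)
  linarith

theorem Bsum_reverse_mul_le_Bsum_mul (r t : ℕ) :
    Bsum (Zl r (t + 1)).reverse * ((sylv (r - t) : ℤ) - 1)
      ≤ Bsum (Zl r (t + 1)) * sylv (r - t) := by
  have hπ := (Zl_bounds r (t + 1)).2.2
  have hβ := (Zl_bounds r t).1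
  have hs : (2 : ℤ) ≤ sylv (r - t) := by exact_mod_cast two_le_sylv (r - t)
  refine (mul_le_mul_of_nonneg_right hπ (by linarith)).trans ?_
  rw [prod_Zl_succ, Bsum_Zl_succ]
  nlinarith

theorem sylv_le_Bsum_reverse_mul_prod (r t k : ℕ) (h : k + (t + 1) = r) :
    (sylv (r + t + 2) : ℝ) ≤ Bsum (Zl r (t + 1)).reverse * ((sylv (k + 1) : ℝ) - 1) *
      ∏ j ∈ Finset.range (t + 1), sylvRatio (k + 1 + j) ^ 2 ^ j := by
  induction t generalizing k with
  | zero =>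
    subst h
    have hγ : (Bsum (Zl (k + 1) 1).reverse : ℝ)
        = sylv (k + 1) * ((sylv (k + 1) : ℝ) - 1) ^ 2 + 1 := by
      have := Bsum_reverse_Zl_succ (k + 1) 0
      simp only [Zl, Bsum, List.reverse_nil, Nat.sub_zero] at this
      simp only [Zl, Nat.sub_zero, Bsum]
      rw [this]
      push_cast
      ring
    simp only [zero_add, Finset.prod_range_one, pow_zero, pow_one, add_zero]
    rw [hγ, sylvRatio, sylv_succ_real (k + 1 + 1), sylv_succ_real (k + 1)]
    have hs := two_le_sylv_real (k + 1)
    generalize (sylv (k + 1) : ℝ) = s at *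
    rw [← sub_nonneg]
    have ha : 0 < s - 1 := by linarith
    have key : (s * (s - 1) ^ 2 + 1) * (s - 1) * ((s * (s - 1) + 1) / (s - 1) ^ 2) -
        ((s * (s - 1) + 1) * (s * (s - 1) + 1 - 1) + 1) =
        ((s - 1) ^ 2 + 1) / (s - 1) := by
      field_simp
      ring
    rw [key]
    positivity
  | succ t ih =>
    have hk : r - (t + 1) = k + 1 := by omega
    have hk' : r - t = k + 2 := by omega
    have hY := ih (k + 1) (by omega)
    have h1 := Bsum_reverse_Zl_succ_ge r (t + 1)
    have h2 := Bsum_reverse_mul_le_Bsum_mul r t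
    have hγ := (Zl_bounds r (t + 1)).2.1
    rw [hk] at h1
    rw [hk'] at h2
    rw [Finset.prod_range_succ']
    have hw : ∏ j ∈ Finset.range (t + 1), sylvRatio (k + 1 + (j + 1)) ^ 2 ^ (j + 1)
        = (∏ j ∈ Finset.range (t + 1), sylvRatio (k + 1 + 1 + j) ^ 2 ^ j) ^ 2 := by
      rw [← Finset.prod_pow]
      refine Finset.prod_congr rfl fun j _ => ?_
      rw [← pow_mul, ← pow_succ, show k + 1 + (j + 1) = k + 1 + 1 + j by ring]
    rw [hw]
    generalize ∏ j ∈ Finset.range (t + 1), sylvRatio (k + 1 + 1 + j) ^ 2 ^ j = w at *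
    have h1' : (sylv (k + 1) : ℝ) * ((sylv (k + 1) : ℝ) - 1) ^ 2 * Bsum (Zl r (t + 1)) *
        Bsum (Zl r (t + 1)).reverse ≤ Bsum (Zl r (t + 1 + 1)).reverse := by
      have : sylv (k + 1) * ((sylv (k + 1) : ℤ) - 1) ^ 2 * Bsum (Zl r (t + 1)) *
        Bsum (Zl r (t + 1)).reverse ≤ Bsum (Zl r (t + 1 + 1)).reverse := by linarith
      exact_mod_cast this
    have h2' : (Bsum (Zl r (t + 1)).reverse : ℝ) * ((sylv (k + 2) : ℝ) - 1)
        ≤ Bsum (Zl r (t + 1)) * sylv (k + 2) := by exact_mod_cast h2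
    have hγ' : (1 : ℝ) ≤ Bsum (Zl r (t + 1)).reverse := by exact_mod_cast hγ
    have hsq := sylv_succ_le_sq (r + t + 2)
    have hs := two_le_sylv_real (k + 1)
    have hY0 := two_le_sylv_real (r + t + 2)
    simp only [add_zero, pow_zero, pow_one, sylvRatio]
    simp only [show k + 1 + 1 = k + 2 by ring, sylv_succ_real (k + 1)] at hY h2' ⊢
    rw [show r + (t + 1) + 2 = r + t + 2 + 1 by ring]
    generalize (sylv (k + 1) : ℝ) = s at *
    generalize (Bsum (Zl r (t + 1 + 1)).reverse : ℝ) = γ' at *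
    generalize (Bsum (Zl r (t + 1)).reverse : ℝ) = γ at *
    generalize (Bsum (Zl r (t + 1)) : ℝ) = β at *
    generalize (sylv (r + t + 2) : ℝ) = Y at *
    have ha : 0 < s - 1 := by linarith
    have hS : 0 < s * (s - 1) + 1 := by positivity
    calc _ ≤ Y ^ 2 := hsq
      _ ≤ (γ * (s * (s - 1) + 1 - 1) * w) ^ 2 := by gcongr
      _ = s * (s - 1) * γ * w ^ 2 * (γ * (s * (s - 1) + 1 - 1)) := by ring
      _ ≤ s * (s - 1) * γ * w ^ 2 * (β * (s * (s - 1) + 1)) := by gcongr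
      _ = (s * (s - 1) ^ 2 * β * γ) * (s - 1) *
          (w ^ 2 * ((s * (s - 1) + 1) / (s - 1) ^ 2)) := by field_simp
      _ ≤ _ := by gcongr

theorem monotone_two_mul_prod_sylvRatio :
    Monotone fun N : ℕ => 2 * ∏ j ∈ Finset.Icc 1 N, sylvRatio j ^ 2 ^ (j - 1) := by
  refine monotone_nat_of_le_succ fun N => ?_
  rw [Finset.prod_Icc_succ_top (by omega)]
  have h0 : 0 ≤ ∏ j ∈ Finset.Icc 1 N, sylvRatio j ^ 2 ^ (j - 1) :=
    Finset.prod_nonneg fun j _ => pow_nonneg (by linarith [one_le_sylvRatio j]) _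
  have h1 : 1 ≤ sylvRatio (N + 1) ^ 2 ^ (N + 1 - 1) := one_le_pow₀ (one_le_sylvRatio _)
  nlinarith

/-- Lemma 8.1 of Esser–Totaro: with
`α := 2·∏_{j=1}^{∞} (s_{j+1}/(s_j − 1)²)^(2^(j−1))`, the numbers `m_{2r} = g_1`
and `m_{2r+1} = g_0` satisfy `s_{2r+1} − 1 ≤ α·m_{2r}` and
`s_{2r+2} − 1 ≤ (3α²/4)·m_{2r+1}`; that is, the mld `1/m_n` of Esser's klt
Calabi–Yau variety of dimension `n` is at most `α/(s_{n+1} − 1)` for `n` even and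
`(3α²/4)/(s_{n+1} − 1)` for `n` odd. -/
theorem mld_comparison (r : ℕ) (hr : 1 ≤ r) (α : ℝ)
    (hα : Filter.Tendsto
      (fun N : ℕ => 2 * ∏ j ∈ Finset.Icc 1 N,
        ((sylv (j + 1) : ℝ) / ((sylv j : ℝ) - 1) ^ 2) ^ 2 ^ (j - 1))
      Filter.atTop (nhds α)) :
    (sylv (2 * r + 1) : ℝ) - 1 ≤ α * (gB r 1 : ℝ) ∧
    (sylv (2 * r + 2) : ℝ) - 1 ≤ (3 * α ^ 2 / 4) * (gB r 0 : ℝ) := by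
  have hα' : 2 * ∏ j ∈ Finset.range r, sylvRatio (0 + 1 + j) ^ 2 ^ j ≤ α := by
    have h := monotone_two_mul_prod_sylvRatio.ge_of_tendsto hα r
    have hprod : ∏ j ∈ Finset.Icc 1 r, sylvRatio j ^ 2 ^ (j - 1)
        = ∏ j ∈ Finset.range r, sylvRatio (0 + 1 + j) ^ 2 ^ j := by
      rw [← Finset.Ico_add_one_right_eq_Icc, Finset.prod_Ico_eq_prod_range]
      simp
    rwa [hprod] at h
  obtain ⟨t, rfl⟩ : ∃ t, r = t + 1 := ⟨r - 1, by omega⟩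
  have hmain := sylv_le_Bsum_reverse_mul_prod (t + 1) t 0 (by omega)
  have hγ : (1 : ℝ) ≤ Bsum (Zl (t + 1) (t + 1)).reverse := by
    exact_mod_cast (Zl_bounds (t + 1) (t + 1)).2.1
  have hs1 : (sylv (0 + 1) : ℝ) = 3 := by norm_num [sylv]
  rw [hs1, show t + 1 + t + 2 = 2 * (t + 1) + 1 by ring] at hmain
  have hg1 : (gB (t + 1) 1 : ℝ) = Bsum (Zl (t + 1) (t + 1)).reverse := rfl
  have hg0 : (gB (t + 1) 0 : ℝ) = Bsum (Zl (t + 1) (t + 1 + 1)).reverse := rfl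
  have hfirst : (sylv (2 * (t + 1) + 1) : ℝ) ≤ α * Bsum (Zl (t + 1) (t + 1)).reverse := by
    nlinarith
  refine ⟨by rw [hg1]; linarith, ?_⟩
  have h1 := Bsum_reverse_Zl_succ_ge (t + 1) (t + 1)
  have h2 := Bsum_reverse_mul_le_Bsum_mul (t + 1) t
  simp only [Nat.sub_self, Nat.add_sub_cancel_left, sylv] at h1 h2
  norm_num at h1 h2
  have h1' : 2 * (Bsum (Zl (t + 1) (t + 1)) : ℝ) * Bsum (Zl (t + 1) (t + 1)).reverse + 1
      ≤ Bsum (Zl (t + 1) (t + 1 + 1)).reverse := by exact_mod_cast h1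
  have h2' : (Bsum (Zl (t + 1) (t + 1)).reverse : ℝ) * 2
      ≤ Bsum (Zl (t + 1) (t + 1)) * 3 := by exact_mod_cast h2
  have hsq := sylv_succ_le_sq (2 * (t + 1) + 1)
  have hY := two_le_sylv_real (2 * (t + 1) + 1)
  rw [hg0, show 2 * (t + 1) + 2 = 2 * (t + 1) + 1 + 1 by ring]
  generalize (Bsum (Zl (t + 1) (t + 1 + 1)).reverse : ℝ) = γ' at *
  generalize (Bsum (Zl (t + 1) (t + 1)).reverse : ℝ) = γ at *
  generalize (Bsum (Zl (t + 1) (t + 1)) : ℝ) = β at *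
  have hγ' : 4 / 3 * γ ^ 2 ≤ γ' := by nlinarith
  calc _ ≤ (sylv (2 * (t + 1) + 1) : ℝ) ^ 2 := by linarith
    _ ≤ (α * γ) ^ 2 := by gcongr
    _ = 3 * α ^ 2 / 4 * (4 / 3 * γ ^ 2) := by ring
    _ ≤ _ := by gcongr
end
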